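/- arXiv:0910.0199 — 5 statements merged into one kernel-verified Lean document; each statement's English description precedes it below -/
import Mathlib

section
/- Let $\epsilon \in (0,1]$ satisfy $(1-\epsilon^2)^2 - 4\epsilon^2 > 0$, let $a > 0$, let $p$ be real, and let $z = x + iy \in \mathbb{C}$ with $|y| \le \epsilon ((x-p)^2 + a^2)^{5/4}$ and $(x-p)^2 + a^2 \le 1$. Then $\left| \mathrm{Im}\left( \frac{1}{((z-p)^2 + a^2)^2} \right) \right| \le \frac{4}{((1-\epsilon^2)^2 - 4\epsilon^2)^2} \cdot \frac{|x-p|\,|y|}{((x-p)^2 + a^2)^3}.$ -/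
/-- The bound `|∂_y u_p| ≤ c₁ |x-p||y| / ((x-p)²+a²)³` with
`c₁ = 4/((1-ε²)² - 4ε²)²`, where `∂_y u_p = Im(1/((z-p)²+a²)²)`. -/
theorem stmt_6 (ε a p : ℝ) (hε : 0 < ε) (hε1 : ε ≤ 1)
    (hεc : 0 < (1 - ε ^ 2) ^ 2 - 4 * ε ^ 2) (ha : 0 < a) (z : ℂ)
    (hy : |z.im| ≤ ε * ((z.re - p) ^ 2 + a ^ 2) ^ ((5 : ℝ) / 4))
    (hx : (z.re - p) ^ 2 + a ^ 2 ≤ 1) :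
    |(1 / ((z - (p : ℂ)) ^ 2 + (a : ℂ) ^ 2) ^ 2).im| ≤
      4 / ((1 - ε ^ 2) ^ 2 - 4 * ε ^ 2) ^ 2 *
        (|z.re - p| * |z.im| / ((z.re - p) ^ 2 + a ^ 2) ^ 3) := by
  set t := z.re - p with ht
  set y := z.im with hyd
  set s := t ^ 2 + a ^ 2 with hs
  set D := (1 - ε ^ 2) ^ 2 - 4 * ε ^ 2 with hD
  have hs0 : 0 < s := by positivity
  have hys : |y| ≤ ε * s := by
    refine hy.trans (mul_le_mul_of_nonneg_left ?_ hε.le)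
    simpa using Real.rpow_le_rpow_of_exponent_ge hs0 hx (by norm_num : (1 : ℝ) ≤ 5 / 4)
  have hysq : y ^ 2 ≤ ε ^ 2 * s := by
    calc y ^ 2 = |y| ^ 2 := (sq_abs y).symm
      _ ≤ (ε * s) ^ 2 := by gcongr
      _ = ε ^ 2 * s * s := by ring
      _ ≤ ε ^ 2 * s * 1 := by gcongr
      _ = ε ^ 2 * s := mul_one _
  have hε2 : 0 ≤ 1 - ε ^ 2 := by nlinarith
  have hlow : (1 - ε ^ 2) * s ≤ s - y ^ 2 := by linarith
  have hnonneg : 0 ≤ s - y ^ 2 := (mul_nonneg hε2 hs0.le).trans hlow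
  have hden : D ^ 2 * s ^ 4 ≤ ((s - y ^ 2) ^ 2 + 4 * t ^ 2 * y ^ 2) ^ 2 := by
    calc D ^ 2 * s ^ 4 ≤ ((1 - ε ^ 2) ^ 2) ^ 2 * s ^ 4 := by
          gcongr
          linarith [sq_nonneg ε]
      _ = (((1 - ε ^ 2) * s) ^ 2) ^ 2 := by ring
      _ ≤ ((s - y ^ 2) ^ 2) ^ 2 := by gcongr
      _ ≤ _ := by
          gcongr
          exact le_add_of_nonneg_right (by positivity)
  have him : (1 / ((z - (p : ℂ)) ^ 2 + (a : ℂ) ^ 2) ^ 2).im =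
      -(4 * (s - y ^ 2) * (t * y)) / ((s - y ^ 2) ^ 2 + 4 * t ^ 2 * y ^ 2) ^ 2 := by
    rw [one_div, Complex.inv_im]
    congr 1
    · simp [pow_two, hs, ht, hyd]
      ring
    · simp [pow_two, Complex.normSq_apply, hs, ht, hyd]
      ring
  rw [him, abs_div, abs_neg, abs_mul, abs_mul t y,
    abs_of_nonneg (show 0 ≤ 4 * (s - y ^ 2) by positivity), abs_sq]
  calc 4 * (s - y ^ 2) * (|t| * |y|) / ((s - y ^ 2) ^ 2 + 4 * t ^ 2 * y ^ 2) ^ 2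
      ≤ 4 * s * (|t| * |y|) / (D ^ 2 * s ^ 4) := by
        gcongr
        exact sub_le_self _ (sq_nonneg y)
    _ = 4 / D ^ 2 * (|t| * |y| / s ^ 3) := by
        field_simp
end

section
/- Let $\epsilon \in (0,1]$ satisfy $(1-\epsilon^2)^2 - 4\epsilon^2 > 0$, let $a > 0$, let $p$ be real, and let $z = x + iy \in \mathbb{C}$ with $|y| \le \epsilon ((x-p)^2 + a^2)^{5/4}$ and $(x-p)^2 + a^2 \le 1$. Then $\mathrm{Re}\left( \frac{1}{((z-p)^2 + a^2)^2} \right) \ge \frac{(1-\epsilon^2)^2 - 4\epsilon^2}{1 + 16\epsilon^2} \cdot \frac{1}{((x-p)^2 + a^2)^2}.$ -/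
/-- The bound `∂_y v_p ≥ c₂ / ((x-p)²+a²)²` with `c₂ = ((1-ε²)² - 4ε²)/(1+16ε²)`,
where `∂_y v_p = Re(1/((z-p)²+a²)²)`. -/
theorem stmt_7 (ε a p : ℝ) (hε : 0 < ε) (hε1 : ε ≤ 1)
    (hεc : 0 < (1 - ε ^ 2) ^ 2 - 4 * ε ^ 2) (ha : 0 < a) (z : ℂ)
    (hy : |z.im| ≤ ε * ((z.re - p) ^ 2 + a ^ 2) ^ ((5 : ℝ) / 4))
    (hx : (z.re - p) ^ 2 + a ^ 2 ≤ 1) :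
    ((1 - ε ^ 2) ^ 2 - 4 * ε ^ 2) / (1 + 16 * ε ^ 2) *
        (1 / ((z.re - p) ^ 2 + a ^ 2) ^ 2) ≤
      (1 / ((z - (p : ℂ)) ^ 2 + (a : ℂ) ^ 2) ^ 2).re := by
  set u := z.re - p with hu
  set y := z.im with hyd
  set R := u ^ 2 + a ^ 2 with hR
  have hR0 : 0 < R := by positivity
  have hRpow : R ^ ((5 : ℝ) / 4) ≤ R := by
    simpa using Real.rpow_le_rpow_of_exponent_ge hR0 hx (by norm_num : (1 : ℝ) ≤ 5 / 4)
  have hyR : |y| ≤ ε * R := hy.trans (mul_le_mul_of_nonneg_left hRpow hε.le)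
  have hy2 : y ^ 2 ≤ ε ^ 2 * R := by
    calc y ^ 2 = |y| ^ 2 := (sq_abs y).symm
      _ ≤ (ε * R) ^ 2 := by gcongr
      _ = ε ^ 2 * R * R := by ring
      _ ≤ ε ^ 2 * R := mul_le_of_le_one_right (by positivity) hx
  have hε2 : ε ^ 2 ≤ 1 := pow_le_one₀ hε.le hε1
  have hu2 : u ^ 2 ≤ R := le_add_of_nonneg_right (sq_nonneg a)
  have huy : u ^ 2 * y ^ 2 ≤ R * y ^ 2 := mul_le_mul_of_nonneg_right hu2 (sq_nonneg y)
  have hN : ((1 - ε ^ 2) ^ 2 - 4 * ε ^ 2) * R ^ 2 ≤ (R - y ^ 2) ^ 2 - (2 * u * y) ^ 2 := by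
    have hle : ε ^ 2 * R ≤ R := mul_le_of_le_one_left hR0.le hε2
    have h := mul_nonneg (sub_nonneg.2 hy2) (by linarith : 0 ≤ 6 * R - ε ^ 2 * R - y ^ 2)
    linarith
  have hN0 : 0 < (R - y ^ 2) ^ 2 - (2 * u * y) ^ 2 := lt_of_lt_of_le (by positivity) hN
  have hD0 : 0 < (R - y ^ 2) ^ 2 + (2 * u * y) ^ 2 := by
    linarith [sq_nonneg (2 * u * y)]
  have hD : ((R - y ^ 2) ^ 2 + (2 * u * y) ^ 2) ^ 2 ≤ (1 + 16 * ε ^ 2) * R ^ 4 := by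
    calc ((R - y ^ 2) ^ 2 + (2 * u * y) ^ 2) ^ 2 ≤ ((R + y ^ 2) ^ 2) ^ 2 := by
          gcongr
          linarith
      _ ≤ ((R + ε ^ 2 * R) ^ 2) ^ 2 := by gcongr
      _ = (1 + ε ^ 2) ^ 4 * R ^ 4 := by ring
      _ ≤ (1 + 16 * ε ^ 2) * R ^ 4 := by
          gcongr
          have he := sq_nonneg ε
          have h2 : (ε ^ 2) ^ 2 ≤ ε ^ 2 := by nlinarith
          have h3 : (ε ^ 2) ^ 3 ≤ ε ^ 2 := by nlinarith
          have h4 : (ε ^ 2) ^ 4 ≤ ε ^ 2 := by nlinarith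
          linarith
  have hre : (1 / ((z - (p : ℂ)) ^ 2 + (a : ℂ) ^ 2) ^ 2).re =
      ((R - y ^ 2) ^ 2 - (2 * u * y) ^ 2) / ((R - y ^ 2) ^ 2 + (2 * u * y) ^ 2) ^ 2 := by
    have hw : (z - (p : ℂ)) ^ 2 + (a : ℂ) ^ 2 = ⟨R - y ^ 2, 2 * u * y⟩ := by
      apply Complex.ext
      · simp [pow_two, hR, hu, hyd]
        ring
      · simp [pow_two, hu, hyd]
        ring
    rw [hw, one_div, Complex.inv_re, map_pow, Complex.normSq_mk]
    simp only [pow_two, Complex.mul_re]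
  rw [hre]
  calc ((1 - ε ^ 2) ^ 2 - 4 * ε ^ 2) / (1 + 16 * ε ^ 2) * (1 / R ^ 2)
      = ((1 - ε ^ 2) ^ 2 - 4 * ε ^ 2) * R ^ 2 / ((1 + 16 * ε ^ 2) * R ^ 4) := by
        field_simp
    _ ≤ _ := div_le_div₀ hN0.le hN (by positivity) hD
end

section
/- Let $\epsilon \in (0,1]$ satisfy $(1-\epsilon^2)^2 - 4\epsilon^2 > 0$, let $a > 0$, let $p, x$ be real with $(x-p)^2 + a^2 \le 1$, and set $y_{p,a}(x) = \epsilon((x-p)^2 + a^2)^{5/4}$. Then $\int_0^{y_{p,a}(x)} \left| \mathrm{Im}\left( \frac{1}{(((x+it)-p)^2 + a^2)^2} \right) \right| dt \le \frac{c_1 \epsilon^2}{2}, \quad \text{where } c_1 = \frac{4}{((1-\epsilon^2)^2 - 4\epsilon^2)^2}.$ -/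
theorem abs_im_one_div_sq (w : ℂ) :
    |(1 / w ^ 2).im| = 2 * |w.re| * |w.im| / (w.re ^ 2 + w.im ^ 2) ^ 2 := by
  have h : (1 / w ^ 2).im = -(2 * w.re * w.im) / (w.re ^ 2 + w.im ^ 2) ^ 2 := by
    rw [one_div, Complex.inv_im, map_pow, Complex.normSq_apply, sq w, Complex.mul_im]
    ring
  rw [h, abs_div, abs_neg, abs_mul, abs_mul, abs_two, abs_of_nonneg (sq_nonneg (w.re ^ 2 + w.im ^ 2))]

/-- A bound on `|Im (1 / ((b + it)² + a²)²)|` that is linear in `t`, with `q ^ 2 = b ^ 2 + a ^ 2`. -/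
theorem abs_im_one_div_sq_le {ε a b q t : ℝ} {w : ℂ} (hq : 0 < q) (hqs : q ^ 2 = b ^ 2 + a ^ 2)
    (ht : 0 ≤ t) (htq : t ^ 2 ≤ ε ^ 2 * q ^ 2) (hε1 : ε ^ 2 ≤ 1)
    (hεc : 0 < (1 - ε ^ 2) ^ 2 - 4 * ε ^ 2)
    (hre : w.re = q ^ 2 - t ^ 2) (him : w.im = 2 * b * t) :
    |(1 / w ^ 2).im| ≤ 4 / (((1 - ε ^ 2) ^ 2 - 4 * ε ^ 2) ^ 2 * q ^ 5) * t := by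
  set K := (1 - ε ^ 2) ^ 2 - 4 * ε ^ 2 with hK
  have hre0 : q ^ 2 * (1 - ε ^ 2) ≤ w.re := by rw [hre]; linarith
  have hre1 : |w.re| ≤ q ^ 2 := by
    rw [abs_of_nonneg (le_trans (by have := sub_nonneg.2 hε1; positivity) hre0), hre]
    linarith [sq_nonneg t]
  have hb : |b| ≤ q := abs_le_of_sq_le_sq (by linarith [sq_nonneg a]) hq.le
  have him1 : |w.im| ≤ 2 * q * t := by
    rw [him, abs_mul, abs_mul, abs_two, abs_of_nonneg ht]
    gcongr
  have hden : K * q ^ 4 ≤ w.re ^ 2 + w.im ^ 2 := by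
    have h1 : (q ^ 2 * (1 - ε ^ 2)) ^ 2 ≤ w.re ^ 2 :=
      pow_le_pow_left₀ (by have := sub_nonneg.2 hε1; positivity) hre0 2
    have h2 : 0 ≤ ε ^ 2 * q ^ 4 := by positivity
    have h3 : K * q ^ 4 = (q ^ 2 * (1 - ε ^ 2)) ^ 2 - 4 * (ε ^ 2 * q ^ 4) := by rw [hK]; ring
    linarith [sq_nonneg w.im]
  rw [abs_im_one_div_sq]
  calc 2 * |w.re| * |w.im| / (w.re ^ 2 + w.im ^ 2) ^ 2
      ≤ 2 * q ^ 2 * (2 * q * t) / (K * q ^ 4) ^ 2 := by gcongr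
    _ = 4 / (K ^ 2 * q ^ 5) * t := by field_simp; ring


/-- The integrated estimate `|u_p(x, y_p(x)) - u_p(x,0)| ≤ c₁ ε² / 2`, obtained by
integrating `|∂_y u_p(x,t)| = |Im(1/(((x+it)-p)²+a²)²)|` from `t = 0` to
`y_{p,a}(x) = ε((x-p)²+a²)^{5/4}`. -/
theorem stmt_8 (ε a p x : ℝ) (hε : 0 < ε) (hε1 : ε ≤ 1)
    (hεc : 0 < (1 - ε ^ 2) ^ 2 - 4 * ε ^ 2) (ha : 0 < a)
    (hx : (x - p) ^ 2 + a ^ 2 ≤ 1) :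
    ∫ t in (0 : ℝ)..(ε * ((x - p) ^ 2 + a ^ 2) ^ ((5 : ℝ) / 4)),
        |(1 / ((((x : ℂ) + t * Complex.I) - (p : ℂ)) ^ 2 + (a : ℂ) ^ 2) ^ 2).im| ≤
      4 / ((1 - ε ^ 2) ^ 2 - 4 * ε ^ 2) ^ 2 * ε ^ 2 / 2 := by
  set s := (x - p) ^ 2 + a ^ 2 with hs
  set K := (1 - ε ^ 2) ^ 2 - 4 * ε ^ 2 with hK
  have hs0 : 0 < s := by positivity
  set q := √s with hq
  have hq0 : 0 < q := Real.sqrt_pos.2 hs0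
  have hqs : q ^ 2 = s := Real.sq_sqrt hs0.le
  have hq1 : q ≤ 1 := Real.sqrt_le_one.2 hx
  set Y := ε * s ^ ((5 : ℝ) / 4) with hY
  have hY0 : 0 ≤ Y := by positivity
  have hYsq : Y ^ 2 = ε ^ 2 * q ^ 5 := by
    rw [hY, mul_pow, hq, Real.sqrt_eq_rpow, ← Real.rpow_natCast, ← Real.rpow_natCast (s ^ _) 2,
      ← Real.rpow_natCast (s ^ _) 5, ← Real.rpow_mul hs0.le, ← Real.rpow_mul hs0.le]
    norm_num
  have hbound : ∀ t ∈ Set.Ioc 0 Y,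
      ‖|(1 / ((((x : ℂ) + t * Complex.I) - (p : ℂ)) ^ 2 + (a : ℂ) ^ 2) ^ 2).im|‖ ≤
        4 / (K ^ 2 * q ^ 5) * t := by
    rintro t ⟨ht0, htY⟩
    rw [Real.norm_eq_abs, abs_abs]
    refine abs_im_one_div_sq_le (a := a) (b := x - p) hq0 hqs ht0.le ?_
      (pow_le_one₀ hε.le hε1) hεc ?_ ?_
    · calc t ^ 2 ≤ Y ^ 2 := by gcongr
        _ = ε ^ 2 * q ^ 5 := hYsq
        _ ≤ ε ^ 2 * q ^ 2 := by
          gcongr ε ^ 2 * ?_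
          exact pow_le_pow_of_le_one hq0.le hq1 (by norm_num)
    · rw [hqs, hs]
      simp [sq]
      ring
    · simp [sq]
      ring
  refine (Real.le_norm_self _).trans <| (intervalIntegral.norm_integral_le_of_norm_le hY0
    (Filter.Eventually.of_forall hbound)
    (Continuous.intervalIntegrable (by fun_prop) _ _)).trans_eq ?_
  rw [intervalIntegral.integral_const_mul, integral_id, hYsq]
  field_simp
  ring
end

section
/- Let $\epsilon \in (0,1]$ satisfy $(1-\epsilon^2)^2 - 4\epsilon^2 > 0$, let $a > 0$, let $p, x$ be real with $(x-p)^2 + a^2 \le 1$, and set $y_{p,a}(x) = \epsilon((x-p)^2 + a^2)^{5/4}$. Then for every $y$ with $y_{p,a}(x)/2 \le y \le y_{p,a}(x)$, $\int_0^{y} \mathrm{Re}\left( \frac{1}{(((x+it)-p)^2 + a^2)^2} \right) dt \ge \frac{\epsilon \, c_2}{2((x-p)^2 + a^2)^{3/4}}, \quad \text{where } c_2 = \frac{(1-\epsilon^2)^2 - 4\epsilon^2}{1 + 16\epsilon^2}.$ -/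
theorem sq_lt_half_of_pos {ε : ℝ} (hε : 0 < ε) (hε1 : ε ≤ 1)
    (hεc : 0 < (1 - ε ^ 2) ^ 2 - 4 * ε ^ 2) : ε ^ 2 < 1 / 2 := by
  have h1 : ε ^ 2 ≤ 1 := pow_le_one₀ hε.le hε1
  nlinarith [mul_nonneg (sq_nonneg ε) (sub_nonneg.2 h1)]

theorem re_one_div_sq_ofReal_add_mul_I (b c : ℝ) :
    (1 / ((b : ℂ) + c * Complex.I) ^ 2).re = (b ^ 2 - c ^ 2) / (b ^ 2 + c ^ 2) ^ 2 := by
  rw [one_div, Complex.inv_re, map_pow, Complex.normSq_add_mul_I]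
  congr 1
  simp [pow_two]

theorem add_mul_I_sub_sq_add_sq (a p x t : ℝ) :
    (((x : ℂ) + t * Complex.I) - (p : ℂ)) ^ 2 + (a : ℂ) ^ 2 =
      (((x - p) ^ 2 + a ^ 2 - t ^ 2 : ℝ) : ℂ) + ((2 * (x - p) * t : ℝ) : ℂ) * Complex.I := by
  push_cast
  linear_combination (t : ℂ) ^ 2 * Complex.I_sq

theorem div_sq_le_re_integrand {ε s u t : ℝ} (hε1 : ε ≤ 1)
    (hεc : 0 < (1 - ε ^ 2) ^ 2 - 4 * ε ^ 2) (hε : 0 < ε) (hs : 0 < s)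
    (hts : t ^ 2 ≤ ε ^ 2 * s) (hts2 : u ^ 2 * t ^ 2 ≤ ε ^ 2 * s ^ 2) :
    (((1 - ε ^ 2) ^ 2 - 4 * ε ^ 2) / (1 + 16 * ε ^ 2)) / s ^ 2 ≤
      ((s - t ^ 2) ^ 2 - (2 * u * t) ^ 2) / ((s - t ^ 2) ^ 2 + (2 * u * t) ^ 2) ^ 2 := by
  have hε2 := sq_lt_half_of_pos hε hε1 hεc
  have hlow : (1 - ε ^ 2) * s ≤ s - t ^ 2 := by linarith
  have hpos : 0 < (1 - ε ^ 2) * s := mul_pos (by linarith) hs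
  have hlow_sq : ((1 - ε ^ 2) * s) ^ 2 ≤ (s - t ^ 2) ^ 2 := pow_le_pow_left₀ hpos.le hlow 2
  have hup_sq : (s - t ^ 2) ^ 2 ≤ s ^ 2 :=
    pow_le_pow_left₀ (hpos.le.trans hlow) (by linarith [sq_nonneg t]) 2
  have hnum : ((1 - ε ^ 2) ^ 2 - 4 * ε ^ 2) * s ^ 2 ≤ (s - t ^ 2) ^ 2 - (2 * u * t) ^ 2 := by
    linarith
  have hden : ((s - t ^ 2) ^ 2 + (2 * u * t) ^ 2) ^ 2 ≤ (1 + 16 * ε ^ 2) * s ^ 4 :=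
    calc ((s - t ^ 2) ^ 2 + (2 * u * t) ^ 2) ^ 2 ≤ ((1 + 4 * ε ^ 2) * s ^ 2) ^ 2 :=
          pow_le_pow_left₀ (by positivity) (by linarith) 2
      _ = (1 + 4 * ε ^ 2) ^ 2 * s ^ 4 := by ring
      _ ≤ (1 + 16 * ε ^ 2) * s ^ 4 := by
          gcongr
          nlinarith [sq_nonneg ε]
  have hden_pos : 0 < ((s - t ^ 2) ^ 2 + (2 * u * t) ^ 2) ^ 2 := by
    have := pow_pos hpos 2
    have := sq_nonneg (2 * u * t)
    exact pow_pos (by linarith) 2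
  calc (((1 - ε ^ 2) ^ 2 - 4 * ε ^ 2) / (1 + 16 * ε ^ 2)) / s ^ 2
      = (((1 - ε ^ 2) ^ 2 - 4 * ε ^ 2) * s ^ 2) / ((1 + 16 * ε ^ 2) * s ^ 4) := by
        field_simp
    _ ≤ _ := div_le_div₀ ((by positivity : (0 : ℝ) ≤ _).trans hnum) hnum hden_pos hden

/-- The integrated estimate `min_{[y_p(x)/2, y_p(x)]} v_p(x,y) ≥ ε c₂ / (2((x-p)²+a²)^{3/4})`,
where `v_p(x,y) = ∫₀^y Re(1/(((x+it)-p)²+a²)²) dt`. -/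
theorem stmt_9 (ε a p x : ℝ) (hε : 0 < ε) (hε1 : ε ≤ 1)
    (hεc : 0 < (1 - ε ^ 2) ^ 2 - 4 * ε ^ 2) (ha : 0 < a)
    (hx : (x - p) ^ 2 + a ^ 2 ≤ 1) :
    ∀ y : ℝ, ε * ((x - p) ^ 2 + a ^ 2) ^ ((5 : ℝ) / 4) / 2 ≤ y →
      y ≤ ε * ((x - p) ^ 2 + a ^ 2) ^ ((5 : ℝ) / 4) →
      ε * (((1 - ε ^ 2) ^ 2 - 4 * ε ^ 2) / (1 + 16 * ε ^ 2)) /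
          (2 * ((x - p) ^ 2 + a ^ 2) ^ ((3 : ℝ) / 4)) ≤
        ∫ t in (0 : ℝ)..y,
          (1 / ((((x : ℂ) + t * Complex.I) - (p : ℂ)) ^ 2 + (a : ℂ) ^ 2) ^ 2).re := by
  intro y hy1 hy2
  simp only [add_mul_I_sub_sq_add_sq, re_one_div_sq_ofReal_add_mul_I]
  have hu : (x - p) ^ 2 ≤ (x - p) ^ 2 + a ^ 2 := by linarith [sq_nonneg a]
  have hs : 0 < (x - p) ^ 2 + a ^ 2 := by positivity
  generalize (x - p) ^ 2 + a ^ 2 = s at *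
  generalize x - p = u at *
  have hy0 : 0 ≤ y := le_trans (by positivity) hy1
  have hys : y ≤ ε * s := by
    refine hy2.trans (mul_le_mul_of_nonneg_left ?_ hε.le)
    simpa using Real.rpow_le_rpow_of_exponent_ge hs hx (by norm_num : (1 : ℝ) ≤ 5 / 4)
  have hε2 := sq_lt_half_of_pos hε hε1 hεc
  have ht : ∀ t ∈ Set.Icc 0 y, t ^ 2 ≤ ε ^ 2 * s := fun t ht =>
    calc t ^ 2 ≤ (ε * s) ^ 2 := pow_le_pow_left₀ ht.1 (ht.2.trans hys) 2
      _ = ε ^ 2 * (s * s) := by ring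
      _ ≤ ε ^ 2 * s := by
        gcongr
        exact mul_le_of_le_one_left hs.le hx
  have hbound : ∀ t ∈ Set.Icc 0 y, (((1 - ε ^ 2) ^ 2 - 4 * ε ^ 2) / (1 + 16 * ε ^ 2)) / s ^ 2 ≤
      ((s - t ^ 2) ^ 2 - (2 * u * t) ^ 2) / ((s - t ^ 2) ^ 2 + (2 * u * t) ^ 2) ^ 2 :=
    fun t h => div_sq_le_re_integrand hε1 hεc hε hs (ht t h) <|
      calc u ^ 2 * t ^ 2 ≤ s * (ε ^ 2 * s) := by gcongr; exact ht t h
        _ = ε ^ 2 * s ^ 2 := by ring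
  have hcont : ContinuousOn (fun t : ℝ => ((s - t ^ 2) ^ 2 - (2 * u * t) ^ 2) /
      ((s - t ^ 2) ^ 2 + (2 * u * t) ^ 2) ^ 2) (Set.uIcc 0 y) := by
    refine ContinuousOn.div (by fun_prop) (by fun_prop) fun t h => ?_
    rw [Set.uIcc_of_le hy0] at h
    have : 0 < s - t ^ 2 := by nlinarith [ht t h]
    positivity
  have hmono := intervalIntegral.integral_mono_on (μ := MeasureTheory.volume) hy0
    intervalIntegrable_const hcont.intervalIntegrable hbound
  rw [intervalIntegral.integral_const, sub_zero, smul_eq_mul] at hmono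
  refine le_trans ?_ hmono
  have hrpow : s ^ ((5 : ℝ) / 4) * s ^ ((3 : ℝ) / 4) = s ^ 2 := by
    rw [← Real.rpow_add hs, ← Real.rpow_natCast]
    norm_num
  have hs34 : 0 < s ^ ((3 : ℝ) / 4) := Real.rpow_pos_of_pos hs _
  have hs54 : 0 < s ^ ((5 : ℝ) / 4) := Real.rpow_pos_of_pos hs _
  calc ε * (((1 - ε ^ 2) ^ 2 - 4 * ε ^ 2) / (1 + 16 * ε ^ 2)) / (2 * s ^ ((3 : ℝ) / 4))
      = ε * s ^ ((5 : ℝ) / 4) / 2 *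
          ((((1 - ε ^ 2) ^ 2 - 4 * ε ^ 2) / (1 + 16 * ε ^ 2)) / s ^ 2) := by
        rw [← hrpow]
        field_simp
    _ ≤ _ := by gcongr
end

section
/- Let $\mu > 1$, $\sigma > 0$, $\alpha > 0$ with $\alpha\sigma - 5/3 \ge 1$, let $\epsilon > 0$ and $C > 0$, and let $\delta \in (0,1)$ satisfy $(\epsilon/2)\delta^{-\alpha} > 1$ and $\xi^{5/3} e^{C/\xi} \ge \xi^{-\alpha}$ for all $0 < \xi < \delta$. Then for all natural numbers $e \le k$ and all reals $x, p, a$ with $(x-p, a) \ne (0,0)$ and $|x - p|, |a| \le \mu^{-\frac{2}{3}(1+\sigma)k} \, \delta^{2/3}/\sqrt{2}$, setting $s = ((x-p)^2 + a^2)^{3/4}$, one has $\frac{\epsilon}{2} \, s^{5/3} \, e^{C \mu^{-e}/s} > 1.$ -/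
open Filter Topology in
/-- A weak inequality on `(0, δ)` between functions continuous at `δ` extends to `(0, δ]`. -/
theorem le_on_Ioc_of_le_on_Ioo {f g : ℝ → ℝ} {δ : ℝ} (hδ : 0 < δ)
    (hf : ContinuousAt f δ) (hg : ContinuousAt g δ)
    (h : ∀ ξ, 0 < ξ → ξ < δ → f ξ ≤ g ξ) {ξ : ℝ} (h0 : 0 < ξ) (h1 : ξ ≤ δ) : f ξ ≤ g ξ := by
  rcases h1.lt_or_eq with h1 | rfl
  · exact h ξ h0 h1
  · refine le_of_tendsto_of_tendsto (hf.tendsto.mono_left (nhdsWithin_le_nhds (s := Set.Iio ξ)))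
      (hg.tendsto.mono_left nhdsWithin_le_nhds) ?_
    filter_upwards [Ioo_mem_nhdsLT hδ] with y hy using h y hy.1 hy.2

/-- If both coordinates are at most `B / √2` in absolute value, then `(u² + v²)^{3/4} ≤ B^{3/2}`. -/
theorem rpow_sq_add_sq_le {u v B : ℝ} (hB : 0 ≤ B) (hu : |u| ≤ B / Real.sqrt 2)
    (hv : |v| ≤ B / Real.sqrt 2) :
    (u ^ 2 + v ^ 2) ^ ((3 : ℝ) / 4) ≤ B ^ ((3 : ℝ) / 2) := by
  have hsq : (B / Real.sqrt 2) ^ 2 = B ^ 2 / 2 := by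
    rw [div_pow, Real.sq_sqrt (by norm_num)]
  have hu2 : u ^ 2 ≤ B ^ 2 / 2 := by
    rw [← hsq, ← sq_abs u]; gcongr
  have hv2 : v ^ 2 ≤ B ^ 2 / 2 := by
    rw [← hsq, ← sq_abs v]; gcongr
  calc (u ^ 2 + v ^ 2) ^ ((3 : ℝ) / 4) ≤ (B ^ 2) ^ ((3 : ℝ) / 4) := by
        gcongr; linarith
    _ = B ^ ((3 : ℝ) / 2) := by
        rw [← Real.rpow_natCast, ← Real.rpow_mul hB]; norm_num

/-- The paper's Lemma: with `s = ((x-p)² + a²)^{3/4}`, if `|x-p|` and `|a|` are at most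
`μ^{-2(1+σ)k/3} δ^{2/3}/√2`, then `(ε/2) s^{5/3} e^{C μ^{-e}/s} > 1` for any
generation `e ≤ k`. -/
theorem stmt_11 (μ σ α ε C δ : ℝ) (hμ : 1 < μ) (hσ : 0 < σ) (hα : 0 < α)
    (hασ : 1 ≤ α * σ - 5 / 3) (hε : 0 < ε) (hC : 0 < C)
    (hδ0 : 0 < δ) (hδ1 : δ < 1) (hδε : 1 < ε / 2 * δ ^ (-α))
    (hΦ : ∀ ξ : ℝ, 0 < ξ → ξ < δ →
      ξ ^ (-α) ≤ ξ ^ ((5 : ℝ) / 3) * Real.exp (C / ξ))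
    (e k : ℕ) (hek : e ≤ k) (x p a : ℝ) (hne : (x - p, a) ≠ (0, 0))
    (hx : |x - p| ≤ μ ^ (-(2 / 3) * (1 + σ) * (k : ℝ)) * δ ^ ((2 : ℝ) / 3) / Real.sqrt 2)
    (ha : |a| ≤ μ ^ (-(2 / 3) * (1 + σ) * (k : ℝ)) * δ ^ ((2 : ℝ) / 3) / Real.sqrt 2) :
    1 < ε / 2 * (((x - p) ^ 2 + a ^ 2) ^ ((3 : ℝ) / 4)) ^ ((5 : ℝ) / 3) *
      Real.exp (C * μ ^ (-(e : ℤ)) / ((x - p) ^ 2 + a ^ 2) ^ ((3 : ℝ) / 4)) := by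
  have hμ0 : 0 < μ := by linarith
  have hbase : 0 < (x - p) ^ 2 + a ^ 2 := by
    rcases eq_or_ne (x - p) 0 with h | h
    · have : a ≠ 0 := fun h' => hne (by rw [h, h'])
      positivity
    · positivity
  have hs := rpow_sq_add_sq_le (by positivity) hx ha
  have hs0 : 0 < ((x - p) ^ 2 + a ^ 2) ^ ((3 : ℝ) / 4) := Real.rpow_pos_of_pos hbase _
  generalize ((x - p) ^ 2 + a ^ 2) ^ ((3 : ℝ) / 4) = s at hs hs0 ⊢
  rw [Real.mul_rpow (by positivity) (by positivity), ← Real.rpow_mul hμ0.le,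
    ← Real.rpow_mul hδ0.le, show (2 : ℝ) / 3 * (3 / 2) = 1 by norm_num, Real.rpow_one] at hs
  set ξ : ℝ := μ ^ (k : ℝ) * s with hξ
  have hξ0 : 0 < ξ := by positivity
  have hξle : ξ ≤ μ ^ (-(σ * k)) * δ := by
    calc ξ ≤ μ ^ (k : ℝ) * (μ ^ (-(2 / 3) * (1 + σ) * (k : ℝ) * (3 / 2)) * δ) := by
          rw [hξ]; gcongr
      _ = μ ^ (-(σ * k)) * δ := by
          rw [← mul_assoc, ← Real.rpow_add hμ0]; ring_nf
  have hξδ : ξ ≤ δ := hξle.trans <| mul_le_of_le_one_left hδ0.le <|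
    Real.rpow_le_one_of_one_le_of_nonpos hμ.le (neg_nonpos.2 (by positivity))
  have hΦξ : ξ ^ (-α) ≤ ξ ^ ((5 : ℝ) / 3) * Real.exp (C / ξ) :=
    le_on_Ioc_of_le_on_Ioo (f := fun ξ => ξ ^ (-α))
      (g := fun ξ => ξ ^ ((5 : ℝ) / 3) * Real.exp (C / ξ)) hδ0
      (Real.continuousAt_rpow_const _ _ (Or.inl hδ0.ne'))
      ((Real.continuousAt_rpow_const _ _ (Or.inl hδ0.ne')).mul
        (continuousAt_const.div continuousAt_id hδ0.ne').rexp) hΦ hξ0 hξδ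
  have hξα : μ ^ (α * σ * k) * δ ^ (-α) ≤ ξ ^ (-α) := by
    calc μ ^ (α * σ * k) * δ ^ (-α) = (μ ^ (-(σ * k)) * δ) ^ (-α) := by
          rw [Real.mul_rpow (by positivity) hδ0.le, ← Real.rpow_mul hμ0.le]; ring_nf
      _ ≤ ξ ^ (-α) := Real.rpow_le_rpow_of_nonpos hξ0 hξle (by linarith)
  have hexp : Real.exp (C / ξ) ≤ Real.exp (C * μ ^ (-(e : ℤ)) / s) := by
    have hpow : (μ ^ k)⁻¹ ≤ (μ ^ e)⁻¹ := by gcongr; exact hμ.le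
    rw [hξ, Real.rpow_natCast, zpow_neg, zpow_natCast, ← div_div, div_eq_mul_inv C]
    gcongr
  have hs53 : s ^ ((5 : ℝ) / 3) = μ ^ (-(5 / 3 * (k : ℝ))) * ξ ^ ((5 : ℝ) / 3) := by
    rw [hξ, Real.mul_rpow (by positivity) hs0.le, ← Real.rpow_mul hμ0.le, ← mul_assoc,
      ← Real.rpow_add hμ0]
    ring_nf
    simp
  have hμα : 1 ≤ μ ^ (-(5 / 3 * (k : ℝ))) * μ ^ (α * σ * k) := by
    rw [← Real.rpow_add hμ0]
    refine Real.one_le_rpow hμ.le ?_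
    have hk : (0 : ℝ) ≤ k := k.cast_nonneg
    nlinarith
  have hδα : δ ^ (-α) ≤ s ^ ((5 : ℝ) / 3) * Real.exp (C * μ ^ (-(e : ℤ)) / s) := by
    calc δ ^ (-α) ≤ μ ^ (-(5 / 3 * (k : ℝ))) * μ ^ (α * σ * k) * δ ^ (-α) :=
          le_mul_of_one_le_left (by positivity) hμα
      _ = μ ^ (-(5 / 3 * (k : ℝ))) * (μ ^ (α * σ * k) * δ ^ (-α)) := mul_assoc _ _ _
      _ ≤ μ ^ (-(5 / 3 * (k : ℝ))) * (ξ ^ ((5 : ℝ) / 3) * Real.exp (C / ξ)) := by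
          exact mul_le_mul_of_nonneg_left (hξα.trans hΦξ) (by positivity)
      _ = s ^ ((5 : ℝ) / 3) * Real.exp (C / ξ) := by rw [hs53, mul_assoc]
      _ ≤ _ := by gcongr
  calc 1 < ε / 2 * δ ^ (-α) := hδε
    _ ≤ ε / 2 * (s ^ ((5 : ℝ) / 3) * Real.exp (C * μ ^ (-(e : ℤ)) / s)) := by gcongr
    _ = _ := (mul_assoc _ _ _).symm
end
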